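/- Let f(n) = a n² + b n + c with a, b, c ∈ ℤ, a odd, b even, and suppose b² − 4ac = 4^ℓ · Δ with ℓ ≥ 2 an integer and Δ an integer whose residue m = Δ mod 8 lies in {2, 3, 5, 6, 7}. Write b = 2k and let a' be any integer with a·a' ≡ 1 (mod 2^ℓ). Then for every n ∈ ℕ (all f(n) are nonzero): (i) if n ≡ a'(1 − k) (mod 2) then ν₂(f(n)) = 0; (ii) if 2 ≤ i < ℓ and n ≡ a'(2^{i−1} − k) (mod 2^i) then ν₂(f(n)) = 2(i−1); (iii) if n ≡ a'(2^{ℓ−1} − k) (mod 2^ℓ) then ν₂(f(n)) = 2(ℓ−1) when m ∈ {2, 6}, ν₂(f(n)) = 2ℓ − 1 when m ∈ {3, 7}, and ν₂(f(n)) = 2ℓ when m = 5; (iv) if n ≡ a'(2^ℓ − k) (mod 2^ℓ) then ν₂(f(n)) = 2ℓ − 1 when m ∈ {2, 6}, and ν₂(f(n)) = 2(ℓ−1) when m ∈ {3, 5, 7}. -/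

import Mathlib

theorem padicValInt_two_eq_of_odd_mul_eq {a x u : ℤ} {e : ℕ} (ha : Odd a) (hu : Odd u)
    (h : a * x = 2 ^ e * u) : padicValInt 2 x = e := by
  have odd_ne : ∀ {y : ℤ}, Odd y → y ≠ 0 := by rintro y ⟨t, ht⟩; omega
  have odd_val : ∀ {y : ℤ}, Odd y → padicValInt 2 y = 0 := fun {y} ⟨t, ht⟩ ↦
    padicValInt.eq_zero_of_not_dvd (by push_cast; omega)
  have hx : x ≠ 0 := by
    rintro rfl
    exact mul_ne_zero (pow_ne_zero e two_ne_zero) (odd_ne hu) (by simpa using h.symm)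
  have h2 : padicValInt 2 ((2 : ℤ) ^ e) = e := by
    simp [padicValInt, Int.natAbs_pow]
  have key := congrArg (padicValInt 2) h
  rwa [padicValInt.mul (odd_ne ha) hx, padicValInt.mul (pow_ne_zero e two_ne_zero) (odd_ne hu),
    odd_val ha, odd_val hu, h2, zero_add, add_zero] at key

theorem exists_mul_add_eq_of_modEq {a a' k n r N M : ℤ} (hNM : N ∣ M) (ha' : a * a' ≡ 1 [ZMOD M])
    (h : n ≡ a' * (r - k) [ZMOD N]) : ∃ t, a * n + k = r + N * t := by
  have h1 : a * n ≡ r - k [ZMOD N] := by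
    simpa [mul_assoc] using (h.mul_left a).trans
      (by simpa [mul_assoc] using (ha'.of_dvd hNM).mul_right (r - k))
  obtain ⟨t, ht⟩ := h1.symm.dvd
  exact ⟨t, by linarith⟩

theorem sq_emod_eight (s : ℤ) : s ^ 2 % 8 = 0 ∨ s ^ 2 % 8 = 1 ∨ s ^ 2 % 8 = 4 := by
  have : s % 8 = 0 ∨ s % 8 = 1 ∨ s % 8 = 2 ∨ s % 8 = 3 ∨ s % 8 = 4 ∨ s % 8 = 5 ∨ s % 8 = 6 ∨
    s % 8 = 7 := by omega
  rcases this with h | h | h | h | h | h | h | h <;> simp [pow_two, Int.mul_emod, h]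


/-- Theorem 2: complete description of the 2-adic valuations of
`f(n) = a n² + b n + c` in the bounded case with `ℓ ≥ 2`, where `b = 2k`,
`b² − 4ac = 4^ℓ Δ`, `m = Δ mod 8 ∈ {2,3,5,6,7}`, and `a'` is an inverse of `a`
modulo `2^ℓ`. -/
theorem stmt_7 (a b c k : ℤ) (ha : Odd a) (hb : b = 2 * k) (ℓ : ℕ) (hℓ : 2 ≤ ℓ)
    (Δ : ℤ) (hdisc : b ^ 2 - 4 * a * c = 4 ^ ℓ * Δ) (m : ℤ) (hm : m = Δ % 8)
    (hmem : m = 2 ∨ m = 3 ∨ m = 5 ∨ m = 6 ∨ m = 7)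
    (a' : ℤ) (ha' : a * a' ≡ 1 [ZMOD (2 ^ ℓ : ℕ)]) :
    ∀ n : ℕ,
      (a * (n : ℤ) ^ 2 + b * (n : ℤ) + c ≠ 0) ∧
      ((n : ℤ) ≡ a' * (1 - k) [ZMOD 2] →
        padicValInt 2 (a * (n : ℤ) ^ 2 + b * (n : ℤ) + c) = 0) ∧
      (∀ i : ℕ, 2 ≤ i → i < ℓ →
        (n : ℤ) ≡ a' * (2 ^ (i - 1) - k) [ZMOD (2 ^ i : ℕ)] →
        padicValInt 2 (a * (n : ℤ) ^ 2 + b * (n : ℤ) + c) = 2 * (i - 1)) ∧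
      ((n : ℤ) ≡ a' * (2 ^ (ℓ - 1) - k) [ZMOD (2 ^ ℓ : ℕ)] →
        ((m = 2 ∨ m = 6) →
          padicValInt 2 (a * (n : ℤ) ^ 2 + b * (n : ℤ) + c) = 2 * (ℓ - 1)) ∧
        ((m = 3 ∨ m = 7) →
          padicValInt 2 (a * (n : ℤ) ^ 2 + b * (n : ℤ) + c) = 2 * ℓ - 1) ∧
        (m = 5 →
          padicValInt 2 (a * (n : ℤ) ^ 2 + b * (n : ℤ) + c) = 2 * ℓ)) ∧
      ((n : ℤ) ≡ a' * (2 ^ ℓ - k) [ZMOD (2 ^ ℓ : ℕ)] →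
        ((m = 2 ∨ m = 6) →
          padicValInt 2 (a * (n : ℤ) ^ 2 + b * (n : ℤ) + c) = 2 * ℓ - 1) ∧
        ((m = 3 ∨ m = 5 ∨ m = 7) →
          padicValInt 2 (a * (n : ℤ) ^ 2 + b * (n : ℤ) + c) = 2 * (ℓ - 1))) := by
  intro n
  obtain ⟨L, rfl⟩ : ∃ L, ℓ = L + 1 := ⟨ℓ - 1, by omega⟩
  subst hb
  set x : ℤ := a * (n : ℤ) ^ 2 + 2 * k * (n : ℤ) + c with hx
  have completed : a * x = (a * n + k) ^ 2 - (2 ^ L) ^ 2 * Δ := by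
    have h4 : (4 : ℤ) ^ (L + 1) = 4 * (2 ^ L) ^ 2 := by
      rw [pow_succ, ← pow_mul, mul_comm L, pow_mul]; norm_num [mul_comm]
    rw [h4] at hdisc
    rw [hx]
    refine mul_left_cancel₀ (four_ne_zero (α := ℤ)) ?_
    linear_combination -hdisc
  have hsq : ((2 : ℤ) ^ L) ^ 2 ≠ 0 := by positivity
  have key : ∀ i ≤ L + 1, ∀ r : ℤ, (n : ℤ) ≡ a' * (r - k) [ZMOD (2 ^ i : ℕ)] →
      ∃ t, a * n + k = r + 2 ^ i * t := fun i hi r h ↦ by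
    simpa using exists_mul_add_eq_of_modEq (Int.natCast_dvd_natCast.2 (pow_dvd_pow 2 hi)) ha' h
  refine ⟨fun h0 ↦ ?_, fun h ↦ ?_, fun i hi hiL h ↦ ?_, fun h ↦ ?_, fun h ↦ ?_⟩
  · have hzero : (a * n + k) ^ 2 = (2 ^ L) ^ 2 * Δ := by
      rw [h0, mul_zero] at completed; linarith
    obtain ⟨s, hs⟩ := (Int.pow_dvd_pow_iff two_ne_zero).1 (Dvd.intro _ hzero.symm)
    have hΔ : Δ = s ^ 2 := mul_left_cancel₀ hsq (by rw [← hzero, hs]; ring)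
    have := sq_emod_eight s
    rw [← hΔ] at this
    omega
  · obtain ⟨t, ht⟩ := key 1 (by omega) 1 (by simpa using h)
    obtain ⟨M, rfl⟩ : ∃ M, L = M + 1 := ⟨L - 1, by omega⟩
    refine padicValInt_two_eq_of_odd_mul_eq (e := 0) ha
      ⟨2 * t ^ 2 + 2 * t - 2 * (2 ^ M) ^ 2 * Δ, ?_⟩ (by rw [pow_zero, one_mul])
    rw [completed, ht]
    ring
  · obtain ⟨t, ht⟩ := key i hiL.le _ h
    obtain ⟨j, rfl⟩ : ∃ j, i = j + 1 := ⟨i - 1, by omega⟩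
    obtain ⟨d, rfl⟩ : ∃ d, L = j + 1 + d := ⟨L - (j + 1), by omega⟩
    refine padicValInt_two_eq_of_odd_mul_eq ha
      (u := 2 * (2 * t ^ 2 + 2 * t - 2 * (2 ^ d) ^ 2 * Δ) + 1) ⟨_, rfl⟩ ?_
    rw [completed, ht, Nat.add_sub_cancel]
    ring
  · obtain ⟨t, ht⟩ := key _ le_rfl _ h
    rw [Nat.add_sub_cancel] at ht ⊢
    obtain ⟨w, hw⟩ : ∃ w, t ^ 2 + t = 2 * w := by
      obtain ⟨w, hw⟩ := Int.even_mul_succ_self t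
      exact ⟨w, by linear_combination hw⟩
    have hfac : a * x = (2 ^ L) ^ 2 * (1 + 8 * w - Δ) := by
      rw [completed, ht]
      linear_combination 4 * (2 ^ L) ^ 2 * hw
    refine ⟨fun hm' ↦ ?_, fun hm' ↦ ?_, fun hm' ↦ ?_⟩
    · exact padicValInt_two_eq_of_odd_mul_eq ha (u := 1 + 8 * w - Δ)
        (by rw [Int.odd_iff]; omega) (by rw [hfac]; ring)
    · obtain ⟨v, hv⟩ : ∃ v, 1 + 8 * w - Δ = 2 * v := ⟨(1 + 8 * w - Δ) / 2, by omega⟩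
      exact padicValInt_two_eq_of_odd_mul_eq ha (u := v)
        (by rw [Int.odd_iff]; omega)
        (by rw [hfac, hv, show 2 * (L + 1) - 1 = 2 * L + 1 by omega]; ring)
    · obtain ⟨v, hv⟩ : ∃ v, 1 + 8 * w - Δ = 4 * v := ⟨(1 + 8 * w - Δ) / 4, by omega⟩
      exact padicValInt_two_eq_of_odd_mul_eq ha (u := v)
        (by rw [Int.odd_iff]; omega) (by rw [hfac, hv]; ring)
  · obtain ⟨t, ht⟩ := key _ le_rfl _ h
    have hfac : a * x = (2 ^ L) ^ 2 * (4 * (1 + t) ^ 2 - Δ) := by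
      rw [completed, ht]
      ring
    generalize (1 + t) ^ 2 = w at hfac
    refine ⟨fun hm' ↦ ?_, fun hm' ↦ ?_⟩
    · obtain ⟨v, hv⟩ : ∃ v, 4 * w - Δ = 2 * v := ⟨(4 * w - Δ) / 2, by omega⟩
      exact padicValInt_two_eq_of_odd_mul_eq ha (u := v)
        (by rw [Int.odd_iff]; omega)
        (by rw [hfac, hv, show 2 * (L + 1) - 1 = 2 * L + 1 by omega]; ring)
    · rw [Nat.add_sub_cancel]
      exact padicValInt_two_eq_of_odd_mul_eq ha (u := 4 * w - Δ)
        (by rw [Int.odd_iff]; omega) (by rw [hfac]; ring)
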